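/- arXiv:2412.19175 — 4 statements merged into one kernel-verified Lean document; each statement's English description precedes it below -/
import Mathlib

section
/- Let P be a d×n projection matrix and let U : ℝ^n → ℂ be continuous and 2π-periodic in each of its n coordinates. Then for every k ∈ ℤ^n the Fourier–Bohr coefficient of the quasiperiodic function u(x) = U(Pᵀx) at the frequency λ_k = Pk exists and equals the k-th Fourier coefficient of the parent function U; that is, lim_{L→∞} (2L)^{−d} ∫_{[−L,L]^d} U(Pᵀx) e^{−i(Pk)·x} dx = (2π)^{−n} ∫_{[0,2π]^n} U(y) e^{−ik·y} dy. -/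
open MeasureTheory Filter Complex

attribute [local instance] instMeasureSpaceUnitAddCircle
  instIsProbabilityMeasureUnitAddCircleVolume

/-- The average of `f` over the cube `[-L, L]^ι`. -/
noncomputable def cubeAverage {ι : Type*} [Fintype ι] (f : (ι → ℝ) → ℂ) (L : ℝ) : ℂ :=
  (((2 * L) ^ Fintype.card ι : ℝ) : ℂ)⁻¹ *
    ∫ x in Set.Icc (fun _ : ι => -L) (fun _ : ι => L), f x

section CubeAverage

variable {ι : Type*} [Fintype ι] {f g : (ι → ℝ) → ℂ}

theorem Continuous.integrableOn_cube (hf : Continuous f) (L : ℝ) :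
    IntegrableOn f (Set.Icc (fun _ : ι => -L) (fun _ : ι => L)) :=
  hf.continuousOn.integrableOn_compact isCompact_Icc

theorem cubeAverage_add (hf : Continuous f) (hg : Continuous g) (L : ℝ) :
    cubeAverage (fun x => f x + g x) L = cubeAverage f L + cubeAverage g L := by
  simp only [cubeAverage]
  rw [integral_add (hf.integrableOn_cube L) (hg.integrableOn_cube L), mul_add]

theorem cubeAverage_const_mul (c : ℂ) (L : ℝ) :
    cubeAverage (fun x => c * f x) L = c * cubeAverage f L := by
  simp only [cubeAverage]
  rw [integral_const_mul, mul_left_comm]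

theorem norm_cubeAverage_le {C : ℝ} (h : ∀ x, ‖f x‖ ≤ C) {L : ℝ} (hL : 0 < L) :
    ‖cubeAverage f L‖ ≤ C := by
  have hvol : volume.real (Set.Icc (fun _ : ι => -L) (fun _ : ι => L)) =
      (2 * L) ^ Fintype.card ι := by
    rw [Measure.real, Real.volume_Icc_pi_toReal fun _ => by linarith]
    simp [two_mul]
  have hbound := norm_setIntegral_le_of_norm_le_const (μ := volume) (f := f)
    (s := Set.Icc (fun _ : ι => -L) (fun _ : ι => L)) isCompact_Icc.measure_lt_top
    (fun x _ => h x)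
  rw [hvol] at hbound
  have hpos : 0 < (2 * L) ^ Fintype.card ι := by positivity
  rw [cubeAverage, norm_mul, norm_inv, norm_real, Real.norm_of_nonneg hpos.le,
    inv_mul_le_iff₀ hpos, mul_comm]
  exact hbound

theorem cubeAverage_prod (F : ι → ℝ → ℂ) (L : ℝ) :
    cubeAverage (fun x => ∏ i, F i (x i)) L =
      ∏ i, ((2 * L : ℝ) : ℂ)⁻¹ * ∫ t in Set.Icc (-L) L, F i t := by
  rw [cubeAverage, Finset.prod_mul_distrib, ← Set.pi_univ_Icc, volume_pi,
    Measure.restrict_pi_pi, integral_fintype_prod_eq_prod,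
    Finset.prod_const, Finset.card_univ, inv_pow, ofReal_pow]

theorem tendsto_average_exp (c : ℝ) :
    Tendsto (fun L : ℝ => ((2 * L : ℝ) : ℂ)⁻¹ * ∫ t in Set.Icc (-L) L, exp (c * I * t))
      atTop (nhds (if c = 0 then 1 else 0)) := by
  split_ifs with hc
  · refine tendsto_const_nhds.congr' ?_
    filter_upwards [eventually_gt_atTop 0] with L hL
    have hne : (L : ℂ) ≠ 0 := ofReal_ne_zero.2 hL.ne'
    have hv : (L + L) ⊔ 0 = L + L := max_eq_left (by linarith)
    simp [hc, hv]
    field_simp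
    norm_num
  · have hc' : (c : ℂ) * I ≠ 0 := mul_ne_zero (ofReal_ne_zero.2 hc) I_ne_zero
    have hlim : Tendsto (fun L : ℝ => (|c|)⁻¹ * L⁻¹) atTop (nhds 0) := by
      simpa using tendsto_inv_atTop_zero.const_mul (|c|)⁻¹
    refine squeeze_zero_norm' ?_ hlim
    filter_upwards [eventually_gt_atTop 0] with L hL
    rw [integral_Icc_eq_integral_Ioc, ← intervalIntegral.integral_of_le (by linarith),
      integral_exp_mul_complex hc']
    have hexp (t : ℝ) : ‖exp (c * I * t)‖ = 1 := by
      rw [show (c : ℂ) * I * t = ((c * t : ℝ) : ℂ) * I by push_cast; ring]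
      exact norm_exp_ofReal_mul_I _
    have hsub := norm_sub_le (exp (c * I * L)) (exp (c * I * (-L : ℝ)))
    rw [hexp, hexp] at hsub
    rw [norm_mul, norm_inv, norm_div, norm_mul, norm_I, norm_real, norm_real, mul_one,
      Real.norm_of_nonneg (by positivity : 0 ≤ 2 * L), Real.norm_eq_abs]
    have : 0 < |c| := abs_pos.2 hc
    calc _ ≤ (2 * L)⁻¹ * ((1 + 1) / |c|) := by gcongr
      _ = |c|⁻¹ * L⁻¹ := by field_simp; norm_num

theorem tendsto_cubeAverage_exp (c : ι → ℝ) :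
    Tendsto (cubeAverage fun x : ι → ℝ => exp (I * ((∑ i, c i * x i : ℝ) : ℂ)))
      atTop (nhds (if c = 0 then 1 else 0)) := by
  have hprod : (cubeAverage fun x : ι → ℝ => exp (I * ((∑ i, c i * x i : ℝ) : ℂ))) =
      fun L : ℝ => ∏ i, ((2 * L : ℝ) : ℂ)⁻¹ * ∫ t in Set.Icc (-L) L, exp (c i * I * t) := by
    ext L
    rw [← cubeAverage_prod]
    congr 1
    ext x
    rw [← exp_sum]
    push_cast
    rw [Finset.mul_sum]
    exact congrArg exp (Finset.sum_congr rfl fun i _ => by ring)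
  have hlim : (if c = 0 then 1 else 0 : ℂ) = ∏ i, if c i = 0 then 1 else 0 := by
    simp [Finset.prod_ite_zero, funext_iff]
  rw [hprod, hlim]
  exact tendsto_finsetProd _ fun i _ => tendsto_average_exp (c i)

end CubeAverage

namespace UnitAddTorus

variable {ι κ : Type*} [Fintype ι] [Fintype κ]

theorem integral_mFourier (m : κ → ℤ) :
    ∫ x : UnitAddTorus κ, mFourier m x = if m = 0 then 1 else 0 := by
  have h := orthonormal_iff_ite.1 (orthonormal_mFourier (d := κ)) 0 m
  rw [ContinuousMap.inner_toLp] at h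
  simpa [mFourier_zero, eq_comm] using h

theorem mFourier_coe (m : κ → ℤ) (z : κ → ℝ) :
    mFourier m (fun j => (z j : UnitAddCircle)) =
      exp (I * ((∑ j, 2 * Real.pi * (m j * z j) : ℝ) : ℂ)) := by
  simp only [mFourier, ContinuousMap.coe_mk, fourier_coe_apply]
  rw [← exp_sum]
  push_cast
  rw [Finset.mul_sum]
  exact congrArg exp (Finset.sum_congr rfl fun i _ => by ring)

/-- Weyl's criterion: cube averages along `φ` converge to the torus integral as soon as they do
for all characters. -/
theorem tendsto_cubeAverage_of_mFourier {φ : (ι → ℝ) → UnitAddTorus κ} (hφ : Continuous φ)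
    (h : ∀ m, Tendsto (cubeAverage fun x => mFourier m (φ x)) atTop
      (nhds (∫ y, mFourier m y))) (f : C(UnitAddTorus κ, ℂ)) :
    Tendsto (cubeAverage fun x => f (φ x)) atTop (nhds (∫ y, f y)) := by
  have hint (g : C(UnitAddTorus κ, ℂ)) : Integrable g (volume : Measure (UnitAddTorus κ)) :=
    g.continuous.integrable_of_hasCompactSupport (HasCompactSupport.of_compactSpace _)
  have hspan (g : C(UnitAddTorus κ, ℂ))
      (hg : g ∈ Submodule.span ℂ (Set.range (mFourier (d := κ)))) :
      Tendsto (cubeAverage fun x => g (φ x)) atTop (nhds (∫ y, g y)) := by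
    induction hg using Submodule.span_induction with
    | mem g hg => obtain ⟨m, rfl⟩ := hg; exact h m
    | zero =>
      have hz : (cubeAverage fun x : ι → ℝ => (0 : C(UnitAddTorus κ, ℂ)) (φ x)) = fun _ => 0 := by
        ext L
        simp [cubeAverage]
      rw [hz]
      simp
    | add g₁ g₂ _ _ h₁ h₂ =>
      simp only [ContinuousMap.add_apply]
      rw [integral_add (hint g₁) (hint g₂)]
      exact (h₁.add h₂).congr fun L =>
        (cubeAverage_add (g₁.continuous.comp hφ) (g₂.continuous.comp hφ) L).symm
    | smul c g _ hg =>
      simp only [ContinuousMap.smul_apply, smul_eq_mul]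
      rw [integral_const_mul]
      exact (hg.const_mul c).congr fun L => (cubeAverage_const_mul c L).symm
  have hmem : f ∈ closure (Submodule.span ℂ (Set.range (mFourier (d := κ))) : Set _) := by
    rw [← Submodule.topologicalClosure_coe, span_mFourier_closure_eq_top]
    trivial
  rw [Metric.tendsto_nhds]
  intro ε hε
  obtain ⟨g, hg, hfg⟩ := Metric.mem_closure_iff.1 hmem (ε / 3) (by positivity)
  rw [dist_eq_norm] at hfg
  filter_upwards [Metric.tendsto_nhds.1 (hspan g hg) (ε / 3) (by positivity),
    eventually_gt_atTop 0] with L hL hpos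
  have hsplit : (cubeAverage fun x => f (φ x)) L =
      cubeAverage (fun x => (f - g) (φ x)) L + cubeAverage (fun x => g (φ x)) L := by
    refine .trans ?_ (cubeAverage_add ((f - g).continuous.comp hφ) (g.continuous.comp hφ) L)
    simp
  have hint_split : ∫ y, f y = (∫ y, (f - g) y) + ∫ y, g y := by
    rw [← integral_add (hint (f - g)) (hint g)]
    simp
  have hA : ‖cubeAverage (fun x => (f - g) (φ x)) L‖ ≤ ‖f - g‖ :=
    norm_cubeAverage_le (fun x => (f - g).norm_coe_le_norm _) hpos
  have hI : ‖∫ y, (f - g) y‖ ≤ ‖f - g‖ := by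
    simpa using norm_integral_le_of_norm_le_const (μ := (volume : Measure (UnitAddTorus κ)))
      (ae_of_all _ fun y => (f - g).norm_coe_le_norm y)
  rw [hsplit, hint_split]
  rw [dist_eq_norm] at hL ⊢
  rw [add_sub_add_comm]
  calc _ ≤ ‖cubeAverage (fun x => (f - g) (φ x)) L - ∫ y, (f - g) y‖ + _ := norm_add_le _ _
    _ < ε := by linarith [norm_sub_le (cubeAverage (fun x => (f - g) (φ x)) L) (∫ y, (f - g) y)]

/-- Continuous functions on `κ → ℝ` that are `1`-periodic in each coordinate descend to the
torus. -/
theorem exists_continuousMap_of_periodic [DecidableEq κ] {V : (κ → ℝ) → ℂ} (hV : Continuous V)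
    (hper : ∀ (l : κ) (z : κ → ℝ), V (z + Pi.single l 1) = V z) :
    ∃ f : C(UnitAddTorus κ, ℂ), ∀ z : κ → ℝ, f (fun j => (z j : UnitAddCircle)) = V z := by
  have hper_int (l : κ) (n : ℤ) (z : κ → ℝ) : V (z + Pi.single l (n : ℝ)) = V z := by
    have := Function.Periodic.int_mul (f := fun t : ℝ => V (z + Pi.single l t)) (c := 1)
      (fun t => by simp only [Pi.single_add, ← add_assoc, hper]) n 0
    simpa using this
  have hper_sum (n : κ → ℤ) (s : Finset κ) (z : κ → ℝ) :
      V (z + ∑ l ∈ s, Pi.single l (n l : ℝ)) = V z := by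
    induction s using Finset.induction_on generalizing z with
    | empty => simp
    | insert l s hl ih => rw [Finset.sum_insert hl, ← add_assoc, ih, hper_int]
  let q : C(κ → ℝ, UnitAddTorus κ) :=
    ⟨fun z j => (z j : UnitAddCircle), continuous_pi fun j =>
      (AddCircle.continuous_mk' 1).comp (continuous_apply j)⟩
  have hq : Topology.IsQuotientMap q :=
    (IsOpenQuotientMap.piMap fun _ : κ =>
      QuotientAddGroup.isOpenQuotientMap_mk (N := AddSubgroup.zmultiples (1 : ℝ))).isQuotientMap
  have hfiber : Function.FactorsThrough (⟨V, hV⟩ : C(κ → ℝ, ℂ)) q := by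
    intro a b hab
    have hdiff (j : κ) : ∃ n : ℤ, (n : ℝ) = b j - a j := by
      have hzero : ((b j - a j : ℝ) : UnitAddCircle) = 0 := by
        rw [AddCircle.coe_sub, sub_eq_zero]
        exact (congrFun hab j).symm
      simpa using (AddCircle.coe_eq_zero_iff 1).1 hzero
    choose n hn using hdiff
    change V a = V b
    rw [← hper_sum n Finset.univ a, Finset.univ_sum_single]
    congr 1
    ext j
    simp [hn]
  exact ⟨hq.lift ⟨V, hV⟩ hfiber, fun z =>
    congrFun (congrArg DFunLike.coe (hq.lift_comp ⟨V, hV⟩ hfiber)) z⟩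

open scoped Pointwise in
/-- The torus integral as an integral over the cube `[0, 2π]^κ`. -/
theorem integral_eq_setIntegral_Icc_two_pi (f : UnitAddTorus κ → ℂ) :
    ∫ y, f y = (((2 * Real.pi) ^ Fintype.card κ : ℝ) : ℂ)⁻¹ *
      ∫ y in Set.Icc (fun _ : κ => (0 : ℝ)) (fun _ : κ => 2 * Real.pi),
        f fun j => ((y j / (2 * Real.pi) : ℝ) : UnitAddCircle) := by
  have hpi : 0 < 2 * Real.pi := Real.two_pi_pos
  have hset : (2 * Real.pi) • Set.Icc (fun _ : κ => (0 : ℝ)) (fun _ : κ => 1) =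
      Set.Icc (fun _ : κ => (0 : ℝ)) (fun _ : κ => 2 * Real.pi) := by
    ext y
    simp only [Set.mem_smul_set_iff_inv_smul_mem₀ hpi.ne', Set.mem_Icc, Pi.le_def, Pi.smul_apply,
      smul_eq_mul, inv_mul_le_iff₀ hpi, mul_one, le_inv_mul_iff₀ hpi, mul_zero]
  have hIoc : {x : κ → ℝ | ∀ i, x i ∈ Set.Ioc (0 : ℝ) (0 + 1)} =
      Set.univ.pi fun _ : κ => Set.Ioc (0 : ℝ) 1 := by
    ext; simp
  have hscale := Measure.setIntegral_comp_smul_of_pos (volume : Measure (κ → ℝ))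
    (fun y => f fun j => ((y j / (2 * Real.pi) : ℝ) : UnitAddCircle))
    (Set.Icc (fun _ : κ => (0 : ℝ)) (fun _ : κ => 1)) hpi
  rw [hset, Module.finrank_fintype_fun_eq_card, real_smul, ofReal_inv] at hscale
  rw [← hscale, integral_preimage f fun _ => 0, hIoc, volume_pi,
    setIntegral_congr_set Measure.univ_pi_Ioc_ae_eq_Icc]
  simp [hpi.ne']

/-- Cube averages of a continuous function along a linear flow on the torus with rationally
independent frequency vectors converge to its integral. -/
theorem tendsto_cubeAverage_linearFlow {P : Matrix ι κ ℝ} (hP : LinearIndependent ℚ P.col)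
    (f : C(UnitAddTorus κ, ℂ)) :
    Tendsto (cubeAverage fun x =>
      f fun j => ((P.transpose.mulVec x j / (2 * Real.pi) : ℝ) : UnitAddCircle))
      atTop (nhds (∫ y, f y)) := by
  refine tendsto_cubeAverage_of_mFourier (continuous_pi fun j =>
    (AddCircle.continuous_mk' 1).comp <| (Continuous.div_const
      ((continuous_apply j).comp (continuous_const.matrix_mulVec continuous_id)) _)) (fun m => ?_) f
  have hchar (x : ι → ℝ) :
      ∑ j, 2 * Real.pi * (m j * (P.transpose.mulVec x j / (2 * Real.pi))) =
        ∑ i, P.mulVec (fun j => (m j : ℝ)) i * x i := by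
    calc _ = (fun j => (m j : ℝ)) ⬝ᵥ P.transpose.mulVec x :=
          Finset.sum_congr rfl fun j _ => by field_simp
      _ = _ := by rw [Matrix.dotProduct_mulVec, Matrix.vecMul_transpose]; rfl
  have hzero : P.mulVec (fun j => (m j : ℝ)) = 0 ↔ m = 0 := by
    refine ⟨fun h => ?_, fun h => ?_⟩
    · have hsum : ∑ j, (m j : ℚ) • P.col j = 0 := by
        ext i
        simpa [Matrix.mulVec, dotProduct, Rat.smul_def, mul_comm] using congrFun h i
      ext j
      simpa using Fintype.linearIndependent_iff.1 hP (fun j => (m j : ℚ)) hsum j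
    · subst h
      exact (congrArg P.mulVec (by ext; simp)).trans P.mulVec_zero
  rw [integral_mFourier]
  simp only [← hzero]
  refine (tendsto_cubeAverage_exp (P.mulVec fun j => (m j : ℝ))).congr fun L => ?_
  congr 1
  ext x
  exact ((mFourier_coe m _).trans (congrArg (fun t : ℝ => exp (I * (t : ℂ))) (hchar x))).symm

end UnitAddTorus

/-- The Fourier–Bohr coefficient of the quasiperiodic function
`u(x) = U(Pᵀx)` at frequency `λ_k = Pk` exists and equals the `k`-th Fourier
coefficient of the periodic parent function `U`. -/
theorem fourierBohr_eq_parent_fourier_coeff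
    (d n : ℕ) (hd : 1 ≤ d) (hdn : d ≤ n)
    (P : Matrix (Fin d) (Fin n) ℝ)
    (hP : LinearIndependent ℚ (fun j : Fin n => fun i : Fin d => P i j))
    (U : (Fin n → ℝ) → ℂ) (hU : Continuous U)
    (hper : ∀ (y : Fin n → ℝ) (l : Fin n),
      U (Function.update y l (y l + 2 * Real.pi)) = U y)
    (k : Fin n → ℤ) :
    Tendsto
      (fun L : ℝ =>
        (((2 * L) ^ d : ℝ) : ℂ)⁻¹ *
          ∫ x in Set.Icc (fun _ : Fin d => -L) (fun _ : Fin d => L),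
            U (Matrix.mulVec P.transpose x) *
              Complex.exp (-Complex.I *
                ((∑ i : Fin d,
                    Matrix.mulVec P (fun j => (k j : ℝ)) i * x i : ℝ) : ℂ)))
      atTop
      (nhds ((((2 * Real.pi) ^ n : ℝ) : ℂ)⁻¹ *
        ∫ y in Set.Icc (fun _ : Fin n => (0 : ℝ)) (fun _ : Fin n => 2 * Real.pi),
          U y * Complex.exp (-Complex.I *
            ((∑ l : Fin n, (k l : ℝ) * y l : ℝ) : ℂ)))) := by
  have hpi : (2 * Real.pi) ≠ 0 := Real.two_pi_pos.ne'
  let V : (Fin n → ℝ) → ℂ := fun y =>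
    U y * exp (-I * ((∑ l, (k l : ℝ) * y l : ℝ) : ℂ))
  have hV : Continuous fun z : Fin n → ℝ => V ((2 * Real.pi) • z) := by
    fun_prop
  have hperV (l : Fin n) (z : Fin n → ℝ) :
      V ((2 * Real.pi) • (z + Pi.single l 1)) = V ((2 * Real.pi) • z) := by
    have harg : (2 * Real.pi) • (z + Pi.single l 1) =
        Function.update ((2 * Real.pi) • z) l (((2 * Real.pi) • z) l + 2 * Real.pi) := by
      ext j
      rcases eq_or_ne j l with rfl | hj
      · simp [mul_add]
      · simp [hj]
    have hsum : ∑ j, (k j : ℝ) * ((2 * Real.pi) • (z + Pi.single l (1 : ℝ)) : Fin n → ℝ) j =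
        ∑ j, (k j : ℝ) * ((2 * Real.pi) • z) j + k l * (2 * Real.pi) := by
      simp [mul_add, Finset.sum_add_distrib, Pi.single_apply]
    have hexp : exp (-I * ((∑ j, (k j : ℝ) * ((2 * Real.pi) • (z + Pi.single l (1 : ℝ)) : Fin n → ℝ) j : ℝ) : ℂ)) =
        exp (-I * ((∑ j, (k j : ℝ) * ((2 * Real.pi) • z) j : ℝ) : ℂ)) := by
      rw [hsum]
      refine exp_eq_exp_iff_exists_int.2 ⟨-k l, ?_⟩
      push_cast
      ring
    simp only [V]
    rw [hexp, harg, hper]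
  obtain ⟨f, hf⟩ := UnitAddTorus.exists_continuousMap_of_periodic hV hperV
  have hfV (y : Fin n → ℝ) :
      f (fun j => ((y j / (2 * Real.pi) : ℝ) : UnitAddCircle)) = V y := by
    rw [hf]
    congr 1
    ext j
    simp [mul_div_cancel₀ _ hpi]
  have hdot (x : Fin d → ℝ) :
      ∑ l, (k l : ℝ) * P.transpose.mulVec x l =
        ∑ i, P.mulVec (fun j => (k j : ℝ)) i * x i := by
    change (fun j => (k j : ℝ)) ⬝ᵥ P.transpose.mulVec x = _
    rw [Matrix.dotProduct_mulVec, Matrix.vecMul_transpose]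
    rfl
  have hlim := UnitAddTorus.tendsto_cubeAverage_linearFlow (P := P) hP f
  rw [UnitAddTorus.integral_eq_setIntegral_Icc_two_pi] at hlim
  simp only [hfV, Fintype.card_fin, V, hdot] at hlim
  refine hlim.congr fun L => ?_
  rw [cubeAverage, Fintype.card_fin]
end

section
/- Let n ≥ 1, let s ≥ 0 be real, let N ≥ 2 be an even integer, and let c : ℤ^n → ℂ satisfy Σ_{k∈ℤ^n} |k|^{2s}|c_k|² < ∞, where |k| denotes the Euclidean norm. Then Σ_{k ∈ ℤ^n ∖ K_N^n} |c_k|² ≤ (N/2)^{−2s} Σ_{k∈ℤ^n} |k|^{2s}|c_k|². (This is the Fourier-coefficient form of the spectral truncation error estimate ‖T_N u − u‖_{L²} ≤ C N^{−s}|U|_{H^s}.) -/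
/-- A frequency with some coordinate outside `[-N/2, N/2)` has Euclidean norm at least `N/2`. -/
theorem half_le_sqrt_sum_sq_of_not_mem_box {ι : Type*} [Fintype ι] {N : ℕ} {k : ι → ℤ}
    (hk : ¬ ∀ l, -(N : ℤ) ≤ 2 * k l ∧ 2 * k l < N) :
    (N : ℝ) / 2 ≤ Real.sqrt (∑ l, (k l : ℝ) ^ 2) := by
  obtain ⟨l, hl⟩ := not_forall.mp hk
  have habs : (N : ℤ) ≤ 2 * |k l| := by
    rcases abs_cases (k l) with h | h <;> omega
  have hcast : (N : ℝ) ≤ 2 * |(k l : ℝ)| := by exact_mod_cast habs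
  calc (N : ℝ) / 2 ≤ |(k l : ℝ)| := by linarith
    _ = Real.sqrt ((k l : ℝ) ^ 2) := (Real.sqrt_sq_eq_abs _).symm
    _ ≤ Real.sqrt (∑ l, (k l : ℝ) ^ 2) :=
      Real.sqrt_le_sqrt
        (Finset.single_le_sum (f := fun l => (k l : ℝ) ^ 2) (fun _ _ => sq_nonneg _)
          (Finset.mem_univ l))

/-- Chebyshev's inequality for weighted sums: if the weight `w` is at least `a` on the set where
`p` holds, the sum of `f` over that set is at most `a ^ (-t)` times the sum of `w ^ t * f`. -/
theorem tsum_subtype_le_rpow_neg_mul_tsum {α : Type*} {p : α → Prop} {w f : α → ℝ} {a t : ℝ}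
    (ha : 0 < a) (ht : 0 ≤ t) (hw : ∀ i, 0 ≤ w i) (hf : ∀ i, 0 ≤ f i)
    (hp : ∀ i, p i → a ≤ w i) (hsum : Summable fun i => w i ^ t * f i) :
    ∑' i : {i // p i}, f i ≤ a ^ (-t) * ∑' i, w i ^ t * f i := by
  have hnonneg : ∀ i, 0 ≤ a ^ (-t) * (w i ^ t * f i) := fun i =>
    mul_nonneg (Real.rpow_nonneg ha.le _) (mul_nonneg (Real.rpow_nonneg (hw i) _) (hf i))
  have hle : ∀ i : {i // p i}, f i ≤ a ^ (-t) * (w i ^ t * f i) := fun i => by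
    have hone : 1 ≤ a ^ (-t) * w i ^ t := by
      rw [Real.rpow_neg ha.le, ← div_eq_inv_mul, one_le_div (Real.rpow_pos_of_pos ha t)]
      exact Real.rpow_le_rpow ha.le (hp i i.2) ht
    rw [← mul_assoc]
    exact le_mul_of_one_le_left (hf i) hone
  have hsum' : Summable fun i => a ^ (-t) * (w i ^ t * f i) := hsum.mul_left _
  have hsub : Summable fun i : {i // p i} => a ^ (-t) * (w i ^ t * f i) :=
    hsum'.comp_injective Subtype.val_injective
  calc ∑' i : {i // p i}, f i
      ≤ ∑' i : {i // p i}, a ^ (-t) * (w i ^ t * f i) :=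
        (hsub.of_nonneg_of_le (fun i => hf i.1) hle).tsum_le_tsum hle hsub
    _ ≤ ∑' i, a ^ (-t) * (w i ^ t * f i) := hsum'.tsum_subtype_le _ {i | p i} hnonneg
    _ = a ^ (-t) * ∑' i, w i ^ t * f i := tsum_mul_left


/-- Fourier-coefficient form of the spectral truncation error
estimate `‖T_N u − u‖_{L²} ≤ C N^{−s} |U|_{H^s}`: the tail of the coefficients
outside `K_N^n` is bounded by `(N/2)^{−2s}` times the `H^s` seminorm squared.
Here `k ∈ K_N^n` means `−N/2 ≤ k_l < N/2` (written as `−N ≤ 2k_l ∧ 2k_l < N`). -/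
theorem truncation_error_coeff (n : ℕ) (hn : 1 ≤ n) (s : ℝ) (hs : 0 ≤ s)
    (N : ℕ) (hN : 2 ≤ N) (hNeven : Even N)
    (c : (Fin n → ℤ) → ℂ)
    (hsum : Summable (fun k : Fin n → ℤ =>
      (Real.sqrt (∑ l : Fin n, ((k l : ℝ)) ^ 2)) ^ (2 * s) * ‖c k‖ ^ 2)) :
    ∑' k : {k : Fin n → ℤ // ¬ (∀ l : Fin n, -(N : ℤ) ≤ 2 * k l ∧ 2 * k l < N)},
        ‖c k.1‖ ^ 2 ≤
      ((N : ℝ) / 2) ^ (-(2 * s)) *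
        ∑' k : Fin n → ℤ,
          (Real.sqrt (∑ l : Fin n, ((k l : ℝ)) ^ 2)) ^ (2 * s) * ‖c k‖ ^ 2 := by
  have hN_pos : (0 : ℝ) < N := by exact_mod_cast (by omega : 0 < N)
  exact tsum_subtype_le_rpow_neg_mul_tsum
    (w := fun k : Fin n → ℤ => Real.sqrt (∑ l, (k l : ℝ) ^ 2)) (f := fun k => ‖c k‖ ^ 2)
    (half_pos hN_pos) (by positivity) (fun _ => Real.sqrt_nonneg _) (fun _ => by positivity)
    (fun _ => half_le_sqrt_sum_sq_of_not_mem_box) hsum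
end

section
/- Let n ≥ 1 and let s > n/2 be real. There exists a constant C, depending only on n and s, such that for every even integer N ≥ 2 and every c : ℤ^n → ℂ with Σ_{k∈ℤ^n} (1+|k|²)^s |c_k|² < ∞, one has Σ_{k ∈ K_N^n} | Σ_{m ∈ ℤ^n, m ≠ 0} c_{k+Nm} |² ≤ C N^{−2s} Σ_{k∈ℤ^n} |k|^{2s}|c_k|². (This aliasing estimate is the Fourier-coefficient content of the interpolation error bound ‖I_N u − u‖_{L²} ≤ C N^{−s}|U|_{H^s}.) -/
/-- **Weighted Cauchy–Schwarz inequality** for infinite sums in a normed space. -/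
theorem norm_tsum_sq_le_tsum_inv_mul_tsum {ι E : Type*} [NormedAddCommGroup E] {c : ι → E}
    {w : ι → ℝ} (hw : ∀ i, 0 < w i) (hw_inv : Summable fun i => (w i)⁻¹)
    (hwc : Summable fun i => w i * ‖c i‖ ^ 2) :
    ‖∑' i, c i‖ ^ 2 ≤ (∑' i, (w i)⁻¹) * ∑' i, w i * ‖c i‖ ^ 2 := by
  have h_inv : ∀ i, 0 ≤ (w i)⁻¹ := fun i => (inv_pos.2 (hw i)).le
  have h_mul : ∀ i, 0 ≤ w i * ‖c i‖ ^ 2 := fun i => mul_nonneg (hw i).le (sq_nonneg _)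
  have h_fin (F : Finset ι) :
      ∑ i ∈ F, ‖c i‖ ≤ √((∑' i, (w i)⁻¹) * ∑' i, w i * ‖c i‖ ^ 2) := by
    refine Real.le_sqrt_of_sq_le ?_
    calc (∑ i ∈ F, ‖c i‖) ^ 2
        ≤ (∑ i ∈ F, (w i)⁻¹) * ∑ i ∈ F, w i * ‖c i‖ ^ 2 :=
          Finset.sum_sq_le_sum_mul_sum_of_sq_le_mul F (fun i _ => h_inv i) (fun i _ => h_mul i)
            fun i _ => (inv_mul_cancel_left₀ (hw i).ne' _).ge
      _ ≤ _ := mul_le_mul (hw_inv.sum_le_tsum F fun i _ => h_inv i)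
          (hwc.sum_le_tsum F fun i _ => h_mul i) (F.sum_nonneg fun i _ => h_mul i)
          (tsum_nonneg h_inv)
  have h_summable : Summable fun i => ‖c i‖ :=
    summable_of_sum_le (fun _ => norm_nonneg _) h_fin
  have h_le : ‖∑' i, c i‖ ≤ √((∑' i, (w i)⁻¹) * ∑' i, w i * ‖c i‖ ^ 2) :=
    (norm_tsum_le_tsum_norm h_summable).trans (h_summable.tsum_le_of_sum_le h_fin)
  calc ‖∑' i, c i‖ ^ 2 ≤ √((∑' i, (w i)⁻¹) * ∑' i, w i * ‖c i‖ ^ 2) ^ 2 := by gcongr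
    _ = _ := Real.sq_sqrt (mul_nonneg (tsum_nonneg h_inv) (tsum_nonneg h_mul))

/-- The sum of `‖m‖ ^ r` over the integer lattice `ℤⁿ` (with the sup norm) converges for
`r < -n`. -/
theorem summable_norm_rpow_pi_int (n : ℕ) {r : ℝ} (hr : r < -n) :
    Summable fun m : Fin n → ℤ => ‖m‖ ^ r := by
  let b := Pi.basisFun ℝ (Fin n)
  let L := Submodule.span ℤ (Set.range b)
  have h_rank : Module.finrank ℤ L = n := by
    rw [ZLattice.rank ℝ L, Module.finrank_fin_fun]
  have h_mem (m : Fin n → ℤ) : (fun l => (m l : ℝ)) ∈ L := by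
    rw [b.mem_span_iff_repr_mem ℤ]
    intro l
    exact ⟨m l, by simp [b]⟩
  let f : (Fin n → ℤ) → L := fun m => ⟨fun l => (m l : ℝ), h_mem m⟩
  have hf : Function.Injective f := fun m m' h => by
    funext l
    exact Int.cast_injective (α := ℝ) (congrFun (congrArg Subtype.val h) l)
  have h_norm (m : Fin n → ℤ) : ‖f m‖ = ‖m‖ := by
    change ‖fun l => (m l : ℝ)‖ = ‖m‖
    simp [Pi.norm_def, nnnorm, Real.norm_eq_abs, Int.norm_eq_abs]
  have h := (ZLattice.summable_norm_rpow L r (by rwa [h_rank])).comp_injective hf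
  simpa only [Function.comp_def, h_norm] using h

/-- Shifting a centred residue `k` modulo `N` by `N m` yields a point of Euclidean norm at least
`N ‖m‖ / 2`. -/
theorem mul_norm_le_two_mul_sqrt_sum_sq {n N : ℕ} {k : Fin n → ℤ}
    (hk : ∀ l, -(N : ℤ) ≤ 2 * k l ∧ 2 * k l < N) (m : Fin n → ℤ) :
    N * ‖m‖ ≤ 2 * √(∑ l, (((k + N • m) l : ℤ) : ℝ) ^ 2) := by
  have h_coord (l : Fin n) : ‖(N • m) l‖ ≤ 2 * √(∑ l, (((k + N • m) l : ℤ) : ℝ) ^ 2) := by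
    have h_int : |(N : ℤ) * m l| ≤ 2 * |k l + N * m l| := by
      rcases eq_or_ne (m l) 0 with h0 | h0
      · simp [h0]
      · have h1 : |2 * k l| ≤ N := abs_le.2 ⟨(hk l).1, (hk l).2.le⟩
        have h2 : (N : ℤ) ≤ |(N : ℤ) * m l| := by
          rw [abs_mul, Nat.abs_cast]
          exact le_mul_of_one_le_right (by positivity) (Int.one_le_abs h0)
        grind
    have h_abs : |(((k + N • m) l : ℤ) : ℝ)| ≤ √(∑ l, (((k + N • m) l : ℤ) : ℝ) ^ 2) :=
      Real.abs_le_sqrt (Finset.single_le_sum (f := fun l => (((k + N • m) l : ℤ) : ℝ) ^ 2)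
        (fun _ _ => sq_nonneg _) (Finset.mem_univ l))
    calc ‖(N • m) l‖ ≤ 2 * |(((k + N • m) l : ℤ) : ℝ)| := by
          rw [Int.norm_eq_abs]
          simpa using (by exact_mod_cast h_int :
            |(((N : ℤ) * m l : ℤ) : ℝ)| ≤ 2 * |((k l + N * m l : ℤ) : ℝ)|)
      _ ≤ _ := by gcongr
  calc N * ‖m‖ = ‖N • m‖ := by
        rw [← natCast_zsmul, norm_smul, Int.norm_natCast]
    _ ≤ _ := (pi_norm_le_iff_of_nonneg (by positivity)).2 h_coord

/-- Every lattice point has at most one representation `k + N m` with `k` a centred residue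
modulo `N`. -/
theorem injective_centred_add_nsmul {n N : ℕ} (hN : 0 < N) :
    Function.Injective fun p : {k : Fin n → ℤ // ∀ l, -(N : ℤ) ≤ 2 * k l ∧ 2 * k l < N} ×
      (Fin n → ℤ) => p.1.1 + N • p.2 := by
  rintro ⟨⟨k, hk⟩, m⟩ ⟨⟨k', hk'⟩, m'⟩ h
  have h_coord (l : Fin n) : k l + N * m l = k' l + N * m' l := by
    simpa using congrFun h l
  have hN' : (0 : ℤ) < N := by exact_mod_cast hN
  have hm (l : Fin n) : m l = m' l := by
    have h1 := h_coord l
    have h2 := hk l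
    have h3 := hk' l
    have h4 : m l - m' l < 1 := by
      refine lt_of_mul_lt_mul_left (a := (N : ℤ)) ?_ hN'.le
      linarith
    have h5 : -1 < m l - m' l := by
      refine lt_of_mul_lt_mul_left (a := (N : ℤ)) ?_ hN'.le
      linarith
    omega
  have hk_eq (l : Fin n) : k l = k' l := by
    have := h_coord l
    rw [hm l] at this
    exact add_right_cancel this
  obtain rfl : k = k' := funext hk_eq
  obtain rfl : m = m' := funext hm
  rfl

/-- aliasing estimate, the Fourier-coefficient content of the
interpolation error bound `‖I_N u − u‖_{L²} ≤ C N^{−s} |U|_{H^s}` for `s > n/2`.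
Here `k ∈ K_N^n` means `−N/2 ≤ k_l < N/2` (written as `−N ≤ 2k_l ∧ 2k_l < N`). -/
theorem aliasing_estimate (n : ℕ) (hn : 1 ≤ n) (s : ℝ) (hs : (n : ℝ) / 2 < s) :
    ∃ C : ℝ, ∀ (N : ℕ), 2 ≤ N → Even N →
      ∀ c : (Fin n → ℤ) → ℂ,
        Summable (fun k : Fin n → ℤ =>
          (1 + ∑ l : Fin n, ((k l : ℝ)) ^ 2) ^ s * ‖c k‖ ^ 2) →
        ∑' k : {k : Fin n → ℤ // ∀ l : Fin n, -(N : ℤ) ≤ 2 * k l ∧ 2 * k l < N},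
            ‖∑' m : {m : Fin n → ℤ // m ≠ 0}, c (k.1 + N • m.1)‖ ^ 2 ≤
          C * (N : ℝ) ^ (-(2 * s)) *
            ∑' k : Fin n → ℤ,
              (Real.sqrt (∑ l : Fin n, ((k l : ℝ)) ^ 2)) ^ (2 * s) * ‖c k‖ ^ 2 := by
  have hn0 : (0 : ℝ) ≤ n := Nat.cast_nonneg n
  have hs0 : 0 < 2 * s := by linarith
  let w : {m : Fin n → ℤ // m ≠ 0} → ℝ := fun m => ‖m.1‖ ^ (2 * s)
  have hw (m) : 0 < w m := Real.rpow_pos_of_pos (norm_pos_iff.2 m.2) _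
  have hw_inv : Summable fun m => (w m)⁻¹ := by
    have h := (summable_norm_rpow_pi_int n (r := -(2 * s)) (by linarith)).comp_injective
      (Subtype.val_injective (p := fun m : Fin n → ℤ => m ≠ 0))
    simpa only [Function.comp_def, Real.rpow_neg (norm_nonneg _)] using h
  refine ⟨(∑' m, (w m)⁻¹) * 2 ^ (2 * s), fun N hN _ c hc => ?_⟩
  have hN0 : (0 : ℝ) < N := by exact_mod_cast (by omega : 0 < N)
  let g : (Fin n → ℤ) → ℝ := fun k => √(∑ l, (k l : ℝ) ^ 2) ^ (2 * s) * ‖c k‖ ^ 2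
  have hg0 (k) : 0 ≤ g k := by positivity
  have hg : Summable g := by
    refine hc.of_nonneg_of_le hg0 fun k => ?_
    have h_nonneg : 0 ≤ ∑ l, (k l : ℝ) ^ 2 := by positivity
    refine mul_le_mul_of_nonneg_right ?_ (sq_nonneg _)
    rw [Real.rpow_mul (Real.sqrt_nonneg _), Real.rpow_two, Real.sq_sqrt h_nonneg]
    exact Real.rpow_le_rpow h_nonneg (by linarith) (by linarith)
  let K := {k : Fin n → ℤ // ∀ l : Fin n, -(N : ℤ) ≤ 2 * k l ∧ 2 * k l < N}
  let φ : K × {m : Fin n → ℤ // m ≠ 0} → (Fin n → ℤ) := fun p => p.1.1 + N • p.2.1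
  have hφ : Function.Injective φ :=
    (injective_centred_add_nsmul (by omega : 0 < N)).comp
      (Function.injective_id.prodMap Subtype.val_injective)
  have hgφ : Summable fun p => g (φ p) := hg.comp_injective hφ
  let B : ℝ := 2 ^ (2 * s) * (N : ℝ) ^ (-(2 * s))
  have h_weight (k : K) (m : {m : Fin n → ℤ // m ≠ 0}) :
      w m * ‖c (φ (k, m))‖ ^ 2 ≤ B * g (φ (k, m)) := by
    rw [← mul_assoc]
    refine mul_le_mul_of_nonneg_right ?_ (sq_nonneg _)
    have h := Real.rpow_le_rpow (by positivity) (mul_norm_le_two_mul_sqrt_sum_sq k.2 m.1) hs0.le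
    rw [Real.mul_rpow hN0.le (norm_nonneg _), Real.mul_rpow zero_le_two (Real.sqrt_nonneg _)] at h
    rw [mul_right_comm, Real.rpow_neg hN0.le, ← div_eq_mul_inv,
      le_div_iff₀ (Real.rpow_pos_of_pos hN0 _), mul_comm]
    exact h
  have h_slice (k : K) : Summable fun m => B * g (φ (k, m)) :=
    (hgφ.prod_factor k).mul_left B
  have h_row (k : K) : ‖∑' m : {m : Fin n → ℤ // m ≠ 0}, c (φ (k, m))‖ ^ 2 ≤
      (∑' m, (w m)⁻¹) * (B * ∑' m, g (φ (k, m))) := by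
    have hwc := (h_slice k).of_nonneg_of_le
      (fun m => mul_nonneg (hw m).le (sq_nonneg _)) (h_weight k)
    refine (norm_tsum_sq_le_tsum_inv_mul_tsum hw hw_inv hwc).trans ?_
    refine mul_le_mul_of_nonneg_left ?_ (tsum_nonneg fun m => (inv_pos.2 (hw m)).le)
    rw [← tsum_mul_left]
    exact hwc.tsum_le_tsum (h_weight k) (h_slice k)
  have h_bound : Summable fun k : K => (∑' m, (w m)⁻¹) * (B * ∑' m, g (φ (k, m))) :=
    (hgφ.prod.mul_left B).mul_left _
  calc ∑' k : K, ‖∑' m : {m : Fin n → ℤ // m ≠ 0}, c (φ (k, m))‖ ^ 2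
      ≤ ∑' k : K, (∑' m, (w m)⁻¹) * (B * ∑' m, g (φ (k, m))) :=
        (h_bound.of_nonneg_of_le (fun _ => sq_nonneg _) h_row).tsum_le_tsum h_row h_bound
    _ = (∑' m, (w m)⁻¹) * (B * ∑' p, g (φ p)) := by
        rw [tsum_mul_left, tsum_mul_left, hgφ.tsum_prod]
    _ ≤ (∑' m, (w m)⁻¹) * (B * ∑' k, g k) := by
        have h_inj : ∑' p, g (φ p) ≤ ∑' k, g k := tsum_comp_le_tsum_of_inj hg hg0 hφ
        have h_inv : 0 ≤ ∑' m, (w m)⁻¹ := tsum_nonneg fun m => (inv_pos.2 (hw m)).le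
        have hB : 0 ≤ B := by positivity
        gcongr
    _ = _ := by ring
end

section
/- Let P be a d×n projection matrix, let s ≥ 0 be real, and let a : ℤ^n → ℂ be finitely supported. Then there exists a constant C such that for every finitely supported V : ℤ^n → ℂ, Σ_{m∈ℤ^n} | Σ_{k∈ℤ^n} a_{m−k} ((Pm)·(Pk)) ((1+|m|²)^{s/2} − (1+|k|²)^{s/2}) V_k |² ≤ C² Σ_{k∈ℤ^n} (1+|k|²)^{s+1} |V_k|². (This is the Fourier-coefficient form of the commutator estimate ‖[D^s, 𝒜]U‖_{L²(𝕋^n)} ≤ C‖U‖_{H^{s+1}(𝕋^n)}.) -/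
theorem sum_sq_convolution_le {G : Type*} [AddCommGroup G] (S : Finset G) (K : G → G → ℂ)
    (g : G → ℝ) (hS : ∀ m k, m - k ∉ S → K m k = 0) (hK : ∀ m k, ‖K m k‖ ≤ g k)
    (hg : Summable fun k => g k ^ 2) :
    ∑' m, ‖∑' k, K m k‖ ^ 2 ≤ (S.card : ℝ) ^ 2 * ∑' k, g k ^ 2 := by
  have h_row (m : G) : ∑' k, K m k = ∑ q ∈ S, K m (m - q) := by
    rw [← (Equiv.subLeft m).tsum_eq (K m)]
    refine tsum_eq_sum fun q hq => hS _ _ ?_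
    simpa using hq
  have h_shift (q : G) : Summable fun m => g (m - q) ^ 2 :=
    (Equiv.subRight q).summable_iff.mpr hg
  have h_le (m : G) : ‖∑' k, K m k‖ ^ 2 ≤ S.card * ∑ q ∈ S, g (m - q) ^ 2 := by
    rw [h_row]
    calc ‖∑ q ∈ S, K m (m - q)‖ ^ 2 ≤ (∑ q ∈ S, g (m - q)) ^ 2 := by
          gcongr
          exact norm_sum_le_of_le _ fun q _ => hK _ _
      _ ≤ S.card * ∑ q ∈ S, g (m - q) ^ 2 := sq_sum_le_card_mul_sum_sq
  have h_sum : Summable fun m => (S.card : ℝ) * ∑ q ∈ S, g (m - q) ^ 2 :=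
    (summable_sum fun q _ => h_shift q).mul_left _
  calc ∑' m, ‖∑' k, K m k‖ ^ 2 ≤ ∑' m, (S.card : ℝ) * ∑ q ∈ S, g (m - q) ^ 2 :=
        (h_sum.of_nonneg_of_le (fun _ => sq_nonneg _) h_le).tsum_le_tsum h_le h_sum
    _ = S.card * ∑ q ∈ S, ∑' m, g (m - q) ^ 2 := by
        rw [tsum_mul_left, Summable.tsum_finsetSum fun q _ => h_shift q]
    _ = S.card * ∑ q ∈ S, ∑' k, g k ^ 2 := by
        congr 1
        exact Finset.sum_congr rfl fun q _ => (Equiv.subRight q).tsum_eq fun k => g k ^ 2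
    _ = (S.card : ℝ) ^ 2 * ∑' k, g k ^ 2 := by
        rw [Finset.sum_const, nsmul_eq_mul]
        ring

theorem exists_abs_rpow_sub_one_le {p : ℝ} (hp : 0 ≤ p) (R : ℝ) :
    ∃ L : ℝ, 0 ≤ L ∧ ∀ t, 0 < t → t ≤ R → |t ^ p - 1| ≤ L * |t - 1| := by
  rcases le_total p 1 with h1 | h1
  · refine ⟨1, zero_le_one, fun t ht _ => ?_⟩
    rw [one_mul]
    rcases le_total t 1 with h | h
    · have h2 := Real.rpow_le_rpow_of_exponent_ge ht h h1
      have h3 := Real.rpow_le_one ht.le h hp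
      rw [Real.rpow_one] at h2
      rw [abs_of_nonpos (by linarith), abs_of_nonpos (by linarith)]
      linarith
    · have h2 := Real.rpow_le_rpow_of_exponent_le h h1
      have h3 := Real.one_le_rpow h hp
      rw [Real.rpow_one] at h2
      rw [abs_of_nonneg (by linarith), abs_of_nonneg (by linarith)]
      linarith
  · have hR : 0 ≤ max R 1 := zero_le_one.trans (le_max_right _ _)
    refine ⟨p * max R 1 ^ (p - 1), by positivity, fun t ht htR => ?_⟩
    have h := (convex_Icc 0 (max R 1)).norm_image_sub_le_of_norm_hasDerivWithin_le
      (f := fun x : ℝ => x ^ p) (f' := fun x => p * x ^ (p - 1))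
      (C := p * max R 1 ^ (p - 1)) (x := 1) (y := t)
      (fun x _ => (Real.hasDerivAt_rpow_const (Or.inr h1)).hasDerivWithinAt)
      (fun x hx => by
        have := Real.rpow_nonneg hx.1 (p - 1)
        rw [Real.norm_of_nonneg (by positivity)]
        gcongr
        · exact hx.1
        · exact hx.2)
      ⟨zero_le_one, le_max_right _ _⟩ ⟨ht.le, htR.trans (le_max_left _ _)⟩
    simpa using h

section Bounds

variable {ι : Type*} [Fintype ι]

theorem one_le_one_add_sum_sq (x : ι → ℝ) : 1 ≤ 1 + ∑ l, x l ^ 2 :=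
  le_add_of_nonneg_right (Finset.sum_nonneg fun _ _ => sq_nonneg _)

theorem one_add_sum_add_sq_le (x y : ι → ℝ) :
    1 + ∑ l, (x l + y l) ^ 2 ≤ 2 * (1 + ∑ l, y l ^ 2) * (1 + ∑ l, x l ^ 2) := by
  have h : ∑ l, (x l + y l) ^ 2 ≤ 2 * ∑ l, x l ^ 2 + 2 * ∑ l, y l ^ 2 := by
    rw [Finset.mul_sum, Finset.mul_sum, ← Finset.sum_add_distrib]
    exact Finset.sum_le_sum fun l _ => by nlinarith [sq_nonneg (x l - y l)]
  nlinarith [Finset.sum_nonneg fun l (_ : l ∈ Finset.univ) => sq_nonneg (x l),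
    Finset.sum_nonneg fun l (_ : l ∈ Finset.univ) => sq_nonneg (y l),
    mul_nonneg (Finset.sum_nonneg fun l (_ : l ∈ Finset.univ) => sq_nonneg (x l))
      (Finset.sum_nonneg fun l (_ : l ∈ Finset.univ) => sq_nonneg (y l))]

theorem abs_sum_mul_le_sqrt (c x : ι → ℝ) :
    |∑ l, c l * x l| ≤ (∑ l, |c l|) * √(1 + ∑ l, x l ^ 2) := by
  rw [Finset.sum_mul]
  refine (Finset.abs_sum_le_sum_abs _ _).trans (Finset.sum_le_sum fun l _ => ?_)
  rw [abs_mul]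
  gcongr
  refine Real.abs_le_sqrt ?_
  have := Finset.single_le_sum (fun l _ => sq_nonneg (x l)) (Finset.mem_univ l)
  linarith

theorem abs_sum_add_sq_sub_le (x y : ι → ℝ) :
    |(1 + ∑ l, (x l + y l) ^ 2) - (1 + ∑ l, x l ^ 2)| ≤
      (2 * ∑ l, |y l| + ∑ l, y l ^ 2) * √(1 + ∑ l, x l ^ 2) := by
  have h : (1 + ∑ l, (x l + y l) ^ 2) - (1 + ∑ l, x l ^ 2) =
      2 * ∑ l, y l * x l + ∑ l, y l ^ 2 := by
    simp only [add_sq, Finset.sum_add_distrib, Finset.mul_sum]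
    rw [Finset.sum_congr rfl fun l _ => show 2 * x l * y l = 2 * (y l * x l) by ring]
    ring
  have h_one : 1 ≤ √(1 + ∑ l, x l ^ 2) := Real.one_le_sqrt.mpr (one_le_one_add_sum_sq x)
  have h_nonneg : 0 ≤ ∑ l, y l ^ 2 := Finset.sum_nonneg fun _ _ => sq_nonneg _
  have h_le := abs_sum_mul_le_sqrt y x
  rw [h]
  refine (abs_add_le _ _).trans ?_
  rw [abs_mul, abs_two, abs_of_nonneg h_nonneg]
  nlinarith

theorem exists_abs_rpow_one_add_sum_sq_sub_le {p : ℝ} (hp : 0 ≤ p) (y : ι → ℝ) :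
    ∃ L : ℝ, ∀ x : ι → ℝ,
      |(1 + ∑ l, (x l + y l) ^ 2) ^ p - (1 + ∑ l, x l ^ 2) ^ p| ≤
        L * (1 + ∑ l, x l ^ 2) ^ (p - 1 / 2) := by
  obtain ⟨L, hL, h⟩ := exists_abs_rpow_sub_one_le hp (2 * (1 + ∑ l, y l ^ 2))
  refine ⟨L * (2 * ∑ l, |y l| + ∑ l, y l ^ 2), fun x => ?_⟩
  have h_ratio := one_add_sum_add_sq_le x y
  have h_sub := abs_sum_add_sq_sub_le x y
  have hv : 0 < 1 + ∑ l, x l ^ 2 := zero_lt_one.trans_le (one_le_one_add_sum_sq x)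
  have hu : 0 < 1 + ∑ l, (x l + y l) ^ 2 :=
    zero_lt_one.trans_le (one_le_one_add_sum_sq fun l => x l + y l)
  set u := 1 + ∑ l, (x l + y l) ^ 2
  set v := 1 + ∑ l, x l ^ 2
  set c := 2 * ∑ l, |y l| + ∑ l, y l ^ 2
  have h_div := h (u / v) (div_pos hu hv) ((div_le_iff₀ hv).mpr h_ratio)
  have hvp : 0 < v ^ p := Real.rpow_pos_of_pos hv p
  have h_factor : u ^ p - v ^ p = v ^ p * ((u / v) ^ p - 1) := by
    rw [Real.div_rpow hu.le hv.le]
    field_simp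
  have h_abs : |u / v - 1| = |u - v| / v := by
    rw [div_sub_one hv.ne', abs_div, abs_of_pos hv]
  have h_exp : v ^ (p - 1 / 2) = v ^ p * (√v / v) := by
    rw [Real.rpow_sub hv, ← Real.sqrt_eq_rpow, Real.sqrt_div_self, div_eq_mul_inv]
  calc |u ^ p - v ^ p| = v ^ p * |(u / v) ^ p - 1| := by
        rw [h_factor, abs_mul, abs_of_pos hvp]
    _ ≤ v ^ p * (L * ((c * √v) / v)) := by
        rw [h_abs] at h_div
        gcongr
        exact h_div.trans (by gcongr)
    _ = L * c * v ^ (p - 1 / 2) := by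
        rw [h_exp]
        ring

theorem exists_abs_mulVec_dotProduct_le {κ : Type*} [Fintype κ] (P : Matrix κ ι ℝ) (y : ι → ℝ) :
    ∃ L : ℝ, ∀ x : ι → ℝ,
      |∑ i, P.mulVec (fun l => x l + y l) i * P.mulVec x i| ≤ L * (1 + ∑ l, x l ^ 2) := by
  refine ⟨∑ i, (∑ l, |P i l|) ^ 2 * √(2 * (1 + ∑ l, y l ^ 2)), fun x => ?_⟩
  rw [Finset.sum_mul]
  refine (Finset.abs_sum_le_sum_abs _ _).trans (Finset.sum_le_sum fun i _ => ?_)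
  have hv : 0 ≤ 1 + ∑ l, x l ^ 2 := zero_le_one.trans (one_le_one_add_sum_sq x)
  have hw : 0 ≤ 2 * (1 + ∑ l, y l ^ 2) := by
    have := one_le_one_add_sum_sq y
    linarith
  have h_sum : |P.mulVec (fun l => x l + y l) i| ≤
      (∑ l, |P i l|) * (√(2 * (1 + ∑ l, y l ^ 2)) * √(1 + ∑ l, x l ^ 2)) := by
    refine (abs_sum_mul_le_sqrt (P i) fun l => x l + y l).trans ?_
    rw [← Real.sqrt_mul hw]
    gcongr
    exact one_add_sum_add_sq_le x y
  rw [abs_mul]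
  calc _ ≤ (∑ l, |P i l|) * (√(2 * (1 + ∑ l, y l ^ 2)) * √(1 + ∑ l, x l ^ 2)) *
        ((∑ l, |P i l|) * √(1 + ∑ l, x l ^ 2)) := by
        gcongr
        exact abs_sum_mul_le_sqrt (P i) x
    _ = (∑ l, |P i l|) ^ 2 * √(2 * (1 + ∑ l, y l ^ 2)) *
        (√(1 + ∑ l, x l ^ 2) * √(1 + ∑ l, x l ^ 2)) := by ring
    _ = _ := by rw [Real.mul_self_sqrt hv]

theorem exists_abs_commutator_symbol_le {κ : Type*} [Fintype κ] (P : Matrix κ ι ℝ) {s : ℝ}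
    (hs : 0 ≤ s) (y : ι → ℝ) :
    ∃ L : ℝ, ∀ x : ι → ℝ,
      |∑ i, P.mulVec (fun l => x l + y l) i * P.mulVec x i| *
        |(1 + ∑ l, (x l + y l) ^ 2) ^ (s / 2) - (1 + ∑ l, x l ^ 2) ^ (s / 2)| ≤
        L * (1 + ∑ l, x l ^ 2) ^ ((s + 1) / 2) := by
  obtain ⟨L₁, h₁⟩ := exists_abs_mulVec_dotProduct_le P y
  obtain ⟨L₂, h₂⟩ := exists_abs_rpow_one_add_sum_sq_sub_le (div_nonneg hs zero_le_two) y
  refine ⟨L₁ * L₂, fun x => ?_⟩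
  have hv : 0 < 1 + ∑ l, x l ^ 2 := zero_lt_one.trans_le (one_le_one_add_sum_sq x)
  refine (mul_le_mul (h₁ x) (h₂ x) (abs_nonneg _) ((abs_nonneg _).trans (h₁ x))).trans_eq ?_
  rw [show (s + 1) / 2 = 1 + (s / 2 - 1 / 2) by ring, Real.rpow_add hv, Real.rpow_one]
  ring

end Bounds

/-- Fourier-coefficient form of the commutator estimate
`‖[D^s, 𝒜]U‖_{L²(𝕋^n)} ≤ C ‖U‖_{H^{s+1}(𝕋^n)}`, where `𝒜` acts on Fourier
coefficients by `(𝒜U)_m = Σ_k a_{m−k} ((Pm)·(Pk)) Û_k` and `D^s` multiplies the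
`k`-th coefficient by `(1+|k|²)^{s/2}`. -/
theorem commutator_estimate (d n : ℕ) (hd : 1 ≤ d) (hdn : d ≤ n)
    (P : Matrix (Fin d) (Fin n) ℝ)
    (hP : LinearIndependent ℚ (fun j : Fin n => fun i : Fin d => P i j))
    (s : ℝ) (hs : 0 ≤ s)
    (a : (Fin n → ℤ) → ℂ) (ha : (Function.support a).Finite) :
    ∃ C : ℝ, ∀ V : (Fin n → ℤ) → ℂ, (Function.support V).Finite →
      ∑' m : Fin n → ℤ,
        ‖∑' k : Fin n → ℤ,
            a (m - k) *
              ((∑ i : Fin d,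
                  Matrix.mulVec P (fun j => (m j : ℝ)) i *
                    Matrix.mulVec P (fun j => (k j : ℝ)) i : ℝ) : ℂ) *
              (((1 + ∑ l : Fin n, ((m l : ℝ)) ^ 2) ^ (s / 2) -
                 (1 + ∑ l : Fin n, ((k l : ℝ)) ^ 2) ^ (s / 2) : ℝ) : ℂ) *
              V k‖ ^ 2 ≤
        C ^ 2 * ∑' k : Fin n → ℤ,
          (1 + ∑ l : Fin n, ((k l : ℝ)) ^ 2) ^ (s + 1) * ‖V k‖ ^ 2 := by
  choose L hL using fun q : Fin n → ℤ =>
    exists_abs_commutator_symbol_le P hs fun l => (q l : ℝ)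
  set S := ha.toFinset with hS
  set M := ∑ q ∈ S, ‖a q‖ * |L q|
  refine ⟨S.card * M, fun V hV => ?_⟩
  have hN (k : Fin n → ℤ) : 0 ≤ 1 + ∑ l, (k l : ℝ) ^ 2 :=
    zero_le_one.trans (one_le_one_add_sum_sq _)
  have h_nonneg (q : Fin n → ℤ) : 0 ≤ ‖a q‖ * |L q| := by positivity
  have hM_nonneg : 0 ≤ M := Finset.sum_nonneg fun q _ => h_nonneg q
  have h_sq (k : Fin n → ℤ) : (M * (1 + ∑ l, (k l : ℝ) ^ 2) ^ ((s + 1) / 2) * ‖V k‖) ^ 2 =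
      M ^ 2 * ((1 + ∑ l, (k l : ℝ) ^ 2) ^ (s + 1) * ‖V k‖ ^ 2) := by
    rw [mul_pow, mul_pow, ← Real.rpow_mul_natCast (hN k), Nat.cast_two,
      div_mul_cancel₀ _ two_ne_zero, mul_assoc]
  refine (sum_sq_convolution_le S _
    (fun k => M * (1 + ∑ l, (k l : ℝ) ^ 2) ^ ((s + 1) / 2) * ‖V k‖) ?_ ?_ ?_).trans_eq ?_
  · intro m k hmk
    have : a (m - k) = 0 := by simpa [hS] using hmk
    simp [this]
  · intro m k
    have h_pow : 0 ≤ (1 + ∑ l, (k l : ℝ) ^ 2) ^ ((s + 1) / 2) := Real.rpow_nonneg (hN k) _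
    by_cases hmk : m - k ∈ S
    · rw [norm_mul, norm_mul, norm_mul, Complex.norm_real, Complex.norm_real, Real.norm_eq_abs,
        Real.norm_eq_abs]
      have h := hL (m - k) fun l => (k l : ℝ)
      simp only [Pi.sub_apply, Int.cast_sub, add_sub_cancel] at h
      refine mul_le_mul_of_nonneg_right ?_ (norm_nonneg _)
      rw [mul_assoc]
      calc _ ≤ ‖a (m - k)‖ * (|L (m - k)| * (1 + ∑ l, (k l : ℝ) ^ 2) ^ ((s + 1) / 2)) := by
            refine mul_le_mul_of_nonneg_left (h.trans ?_) (norm_nonneg _)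
            gcongr
            exact le_abs_self _
        _ ≤ _ := by
            rw [← mul_assoc]
            gcongr
            exact Finset.single_le_sum (fun q _ => h_nonneg q) hmk
    · have : a (m - k) = 0 := by simpa [hS] using hmk
      rw [this]
      simp only [zero_mul, norm_zero]
      positivity
  · refine summable_of_hasFiniteSupport (hV.subset fun k hk => ?_)
    contrapose! hk
    simp_all
  · simp only [h_sq]
    rw [tsum_mul_left]
    ring
end
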